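/- arXiv:1704.04641 — 10 statements merged into one kernel-verified Lean document; each statement's English description precedes it below -/
import Mathlib

section
/- Let C₁, C₂, C₁₃, C₁₄, C₂₃, C₂₄, D₁, D₂, D₃, D₄ be real numbers with D₂ ≤ D₁, and let (R₁, R₂, R₃, R₄) be real numbers with R₂ ≤ R₁. Then the system of inequalities {R₁+R₃ ≤ min(C₁₃, max(D₂,D₄)), R₁+R₄ ≤ min(C₁₄, max(D₂,D₃)), R₂+R₃ ≤ min(C₂₃, max(D₁,D₄)), R₂+R₄ ≤ min(C₂₄, max(D₁,D₃)), R₁ ≤ min(C₁,D₂), R₂ ≤ min(C₂,D₁)} holds if and only if the system {R₁+R₃ ≤ min(C₁₃, max(D₂,D₄)), R₁+R₄ ≤ min(C₁₄, max(D₂,D₃)), R₂+R₃ ≤ min(C₂₃, max(D₂,D₄)), R₂+R₄ ≤ min(C₂₄, max(D₂,D₃)), R₁ ≤ min(C₁,D₂), R₂ ≤ min(C₂,D₂)} holds. -/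
theorem stmt1 (C1 C2 C13 C14 C23 C24 D1 D2 D3 D4 R1 R2 R3 R4 : ℝ)
    (hD : D2 ≤ D1) (hR : R2 ≤ R1) :
    (R1 + R3 ≤ min C13 (max D2 D4) ∧ R1 + R4 ≤ min C14 (max D2 D3) ∧
     R2 + R3 ≤ min C23 (max D1 D4) ∧ R2 + R4 ≤ min C24 (max D1 D3) ∧
     R1 ≤ min C1 D2 ∧ R2 ≤ min C2 D1) ↔
    (R1 + R3 ≤ min C13 (max D2 D4) ∧ R1 + R4 ≤ min C14 (max D2 D3) ∧
     R2 + R3 ≤ min C23 (max D2 D4) ∧ R2 + R4 ≤ min C24 (max D2 D3) ∧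
     R1 ≤ min C1 D2 ∧ R2 ≤ min C2 D2) := by
  have h4 : max D2 D4 ≤ max D1 D4 := max_le_max_right D4 hD
  have h3 : max D2 D3 ≤ max D1 D3 := max_le_max_right D3 hD
  simp only [le_min_iff]
  constructor
  · rintro ⟨⟨h13, hm4⟩, ⟨h14, hm3⟩, ⟨h23, -⟩, ⟨h24, -⟩, ⟨hC1, hD2⟩, hC2, -⟩
    exact ⟨⟨h13, hm4⟩, ⟨h14, hm3⟩, ⟨h23, by linarith⟩, ⟨h24, by linarith⟩, ⟨hC1, hD2⟩,
      hC2, hR.trans hD2⟩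
  · rintro ⟨h13, h14, ⟨h23, hm4⟩, ⟨h24, hm3⟩, h1, hC2, hD2⟩
    exact ⟨h13, h14, ⟨h23, hm4.trans h4⟩, ⟨h24, hm3.trans h3⟩, h1, hC2, hD2.trans hD⟩
end

section
/- Define R₁₁ = (1/2)·log(1 + p₁₁/(2p₁₀ + 2p₃₀ + p₃₁ + σ)), R₁₀ = (1/2)·[log(1/2 + p₁₀/(2p₃₀ + p₃₁ + σ))]⁺, R₃₁ = (1/2)·log(1 + p₃₁/(2p₃₀ + σ)), and R₃₀ = (1/2)·[log(1/2 + p₃₀/σ)]⁺. Then R₁₀ + R₁₁ ≥ (C₁₃ − C₃) − 1/2, R₁₀ ≥ (C₂₃ − C₃) − 1/2, R₃₀ + R₃₁ ≥ C₃ − 1/2, and R₃₀ ≥ C₄ − 1/2. -/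
theorem logb_two_one_add_div {x s : ℝ} (hx : 0 ≤ x) (hs : 0 < s) :
    Real.logb 2 (1 + x / s) = Real.logb 2 (s + x) - Real.logb 2 s := by
  rw [← Real.logb_div (by positivity) hs.ne']
  congr 1
  field_simp

theorem logb_two_half_add_half_div {x s : ℝ} (hx : 0 ≤ x) (hs : 0 < s) :
    Real.logb 2 (1 / 2 + x / 2 / s) = Real.logb 2 (s + x) - Real.logb 2 s - 1 := by
  have h : 1 / 2 + x / 2 / s = (1 + x / s) / 2 := by ring
  rw [h, Real.logb_div (by positivity) two_ne_zero, logb_two_one_add_div hx hs,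
    Real.logb_self_eq_one one_lt_two]

theorem stmt4 (a1 a2 a3 a4 σ p10 p30 p11 p31 C1 C2 C3 C4 C13 C14 C23 C24 R10 R11 R30 R31 : ℝ)
    (ha1 : 0 < a1) (ha2 : 0 < a2) (ha3 : 0 < a3) (ha4 : 0 < a4) (hσ : 0 < σ)
    (h12 : a2 ≤ a1) (h34 : a4 ≤ a3)
    (hC1 : C1 = 1/2 * Real.logb 2 (1 + a1/σ))
    (hC2 : C2 = 1/2 * Real.logb 2 (1 + a2/σ))
    (hC3 : C3 = 1/2 * Real.logb 2 (1 + a3/σ))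
    (hC4 : C4 = 1/2 * Real.logb 2 (1 + a4/σ))
    (hC13 : C13 = 1/2 * Real.logb 2 (1 + (a1 + a3)/σ))
    (hC14 : C14 = 1/2 * Real.logb 2 (1 + (a1 + a4)/σ))
    (hC23 : C23 = 1/2 * Real.logb 2 (1 + (a2 + a3)/σ))
    (hC24 : C24 = 1/2 * Real.logb 2 (1 + (a2 + a4)/σ))
    (hp10 : p10 = a2/2) (hp30 : p30 = a4/2)
    (hp11 : p11 = a1 - a2) (hp31 : p31 = a3 - a4)
    (hR11 : R11 = 1/2 * Real.logb 2 (1 + p11/(2*p10 + 2*p30 + p31 + σ)))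
    (hR10 : R10 = 1/2 * max (Real.logb 2 (1/2 + p10/(2*p30 + p31 + σ))) 0)
    (hR31 : R31 = 1/2 * Real.logb 2 (1 + p31/(2*p30 + σ)))
    (hR30 : R30 = 1/2 * max (Real.logb 2 (1/2 + p30/σ)) 0) :
    R10 + R11 ≥ (C13 - C3) - 1/2 ∧ R10 ≥ (C23 - C3) - 1/2 ∧
    R30 + R31 ≥ C3 - 1/2 ∧ R30 ≥ C4 - 1/2 := by 
  subst p10 p30 p11 p31
  have e1 : 2 * (a2 / 2) + 2 * (a4 / 2) + (a3 - a4) + σ = σ + (a2 + a3) := by ring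
  have e2 : 2 * (a4 / 2) + (a3 - a4) + σ = σ + a3 := by ring
  have e3 : 2 * (a4 / 2) + σ = σ + a4 := by ring
  have e4 : σ + (a2 + a3) + (a1 - a2) = σ + (a1 + a3) := by ring
  have e5 : σ + a3 + a2 = σ + (a2 + a3) := by ring
  have e6 : σ + a4 + (a3 - a4) = σ + a3 := by ring
  rw [logb_two_one_add_div (by positivity) hσ] at hC3 hC4 hC13 hC23
  rw [e1, logb_two_one_add_div (sub_nonneg.2 h12) (by positivity), e4] at hR11
  rw [e3, logb_two_one_add_div (sub_nonneg.2 h34) (by positivity), e6] at hR31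
  rw [e2, logb_two_half_add_half_div ha2.le (by positivity), e5] at hR10
  rw [logb_two_half_add_half_div ha4.le hσ] at hR30
  have m10 := le_max_left
    (Real.logb 2 (σ + (a2 + a3)) - Real.logb 2 (σ + a3) - 1) 0
  have m30 := le_max_left (Real.logb 2 (σ + a4) - Real.logb 2 σ - 1) 0
  refine ⟨?_, ?_, ?_, ?_⟩ <;> linarith
end

section
/- Define R₃₁ = (1/2)·log(1 + p₃₁/(2p₁₀ + 2p₃₀ + p₁₁ + σ)), R₁₁ = (1/2)·log(1 + p₁₁/(2p₁₀ + 2p₃₀ + σ)), R₁₀ = (1/2)·[log(1/2 + p₁₀/(2p₃₀ + σ))]⁺, and R₃₀ = (1/2)·[log(1/2 + p₃₀/σ)]⁺. Then R₁₀ + R₁₁ ≥ (C₁₄ − C₄) − 1/2, R₁₀ ≥ (C₂₄ − C₄) − 1/2, R₃₀ + R₃₁ ≥ (C₁₃ − C₁₄ + C₄) − 1/2, and R₃₀ ≥ C₄ − 1/2. -/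
lemma logb_one_add_div {b x y : ℝ} (hy : 0 < y) (hxy : 0 < x + y) :
    Real.logb b (1 + x / y) = Real.logb b (x + y) - Real.logb b y := by
  rw [one_add_div hy.ne', add_comm y x, Real.logb_div hxy.ne' hy.ne']

lemma logb_half_add_div {x y : ℝ} (hy : 0 < y) (hxy : 0 < x + y) :
    Real.logb 2 (1 / 2 + x / 2 / y) = Real.logb 2 (x + y) - Real.logb 2 y - 1 := by
  have h : 1 / 2 + x / 2 / y = (x + y) / y / 2 := by
    field_simp
    ring
  rw [h, Real.logb_div (div_pos hxy hy).ne' two_ne_zero, Real.logb_div hxy.ne' hy.ne',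
    Real.logb_self_eq_one one_lt_two]

theorem stmt7 (a1 a2 a3 a4 σ p10 p30 p11 p31 C1 C2 C3 C4 C13 C14 C23 C24 R10 R11 R30 R31 : ℝ)
    (ha1 : 0 < a1) (ha2 : 0 < a2) (ha3 : 0 < a3) (ha4 : 0 < a4) (hσ : 0 < σ)
    (h12 : a2 ≤ a1) (h34 : a4 ≤ a3)
    (hC1 : C1 = 1/2 * Real.logb 2 (1 + a1/σ))
    (hC2 : C2 = 1/2 * Real.logb 2 (1 + a2/σ))
    (hC3 : C3 = 1/2 * Real.logb 2 (1 + a3/σ))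
    (hC4 : C4 = 1/2 * Real.logb 2 (1 + a4/σ))
    (hC13 : C13 = 1/2 * Real.logb 2 (1 + (a1 + a3)/σ))
    (hC14 : C14 = 1/2 * Real.logb 2 (1 + (a1 + a4)/σ))
    (hC23 : C23 = 1/2 * Real.logb 2 (1 + (a2 + a3)/σ))
    (hC24 : C24 = 1/2 * Real.logb 2 (1 + (a2 + a4)/σ))
    (hp10 : p10 = a2/2) (hp30 : p30 = a4/2)
    (hp11 : p11 = a1 - a2) (hp31 : p31 = a3 - a4)
    (hR31 : R31 = 1/2 * Real.logb 2 (1 + p31/(2*p10 + 2*p30 + p11 + σ)))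
    (hR11 : R11 = 1/2 * Real.logb 2 (1 + p11/(2*p10 + 2*p30 + σ)))
    (hR10 : R10 = 1/2 * max (Real.logb 2 (1/2 + p10/(2*p30 + σ))) 0)
    (hR30 : R30 = 1/2 * max (Real.logb 2 (1/2 + p30/σ)) 0) :
    R10 + R11 ≥ (C14 - C4) - 1/2 ∧ R10 ≥ (C24 - C4) - 1/2 ∧
    R30 + R31 ≥ (C13 - C14 + C4) - 1/2 ∧ R30 ≥ C4 - 1/2 := by
  subst hp10 hp30 hp11 hp31
  rw [logb_one_add_div hσ (by linarith)] at hC4 hC13 hC14 hC24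
  rw [show 2*(a2/2) + 2*(a4/2) + (a1 - a2) + σ = a1 + a4 + σ by ring,
    logb_one_add_div (by linarith) (by linarith),
    show a3 - a4 + (a1 + a4 + σ) = a1 + a3 + σ by ring] at hR31
  rw [show 2*(a2/2) + 2*(a4/2) + σ = a2 + a4 + σ by ring,
    logb_one_add_div (by linarith) (by linarith),
    show a1 - a2 + (a2 + a4 + σ) = a1 + a4 + σ by ring] at hR11
  rw [show 2*(a4/2) + σ = a4 + σ by ring,
    logb_half_add_div (by linarith) (by linarith), ← add_assoc] at hR10
  rw [logb_half_add_div hσ (by linarith)] at hR30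
  have h10 := le_max_left (Real.logb 2 (a2 + a4 + σ) - Real.logb 2 (a4 + σ) - 1) 0
  have h30 := le_max_left (Real.logb 2 (a4 + σ) - Real.logb 2 σ - 1) 0
  refine ⟨?_, ?_, ?_, ?_⟩ <;> linarith
end

section
/- Suppose b₃ ≥ b₄ ≥ b₁ ≥ b₂ > 0. Set q₂ = min(P, b₄) and q₁ = P − q₂. Then (1/2)·log(1 + q₂/b₂) + 1/2 ≥ D₂ − D₄, (1/2)·log(1 + q₂/b₁) + 1/2 ≥ D₁ − D₄, (1/2)·log(1 + q₁/(q₂ + b₄)) + 1/2 ≥ D₄, and (1/2)·log(1 + q₁/(q₂ + b₃)) + 1/2 ≥ D₃. -/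
theorem half_logb_two_le_add_half {x y : ℝ} (hx : 0 < x) (hxy : x ≤ 2 * y) :
    1/2 * Real.logb 2 x ≤ 1/2 * Real.logb 2 y + 1/2 := by
  have hy : 0 < y := by linarith
  have h := Real.logb_le_logb_of_le one_lt_two hx hxy
  rw [Real.logb_mul two_ne_zero hy.ne', Real.logb_self_eq_one one_lt_two] at h
  linarith

theorem one_add_div_le_mul_one_add_min_div {b c P : ℝ} (hb : 0 < b) (hc : 0 < c) (hP : 0 < P) :
    1 + P/b ≤ (1 + min P c/b) * (1 + P/c) := by
  have hPb : 0 < P/b := by positivity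
  have hPc : 0 < P/c := by positivity
  have hcb : 0 < c/b := by positivity
  rcases min_choice P c with h | h <;> rw [h]
  · nlinarith
  · have hmul : c/b * (P/c) = P/b := by field_simp
    linarith

theorem half_logb_sub_le {b c P : ℝ} (hb : 0 < b) (hc : 0 < c) (hP : 0 < P) :
    1/2 * Real.logb 2 (1 + P/b) - 1/2 * Real.logb 2 (1 + P/c) ≤
      1/2 * Real.logb 2 (1 + min P c/b) := by
  have hq : 0 < min P c := lt_min hP hc
  have hx : 0 < 1 + P/b := by positivity
  have hy : 0 < 1 + min P c/b := by positivity
  have hz : 0 < 1 + P/c := by positivity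
  have h := Real.logb_le_logb_of_le one_lt_two hx (one_add_div_le_mul_one_add_min_div hb hc hP)
  rw [Real.logb_mul hy.ne' hz.ne'] at h
  linarith

theorem half_logb_le_residual_add_half {b q P : ℝ} (hb : 0 < b) (hq : 0 < q) (hqb : q ≤ b)
    (hP : 0 < P) :
    1/2 * Real.logb 2 (1 + P/b) ≤ 1/2 * Real.logb 2 (1 + (P - q)/(q + b)) + 1/2 := by
  refine half_logb_two_le_add_half (by positivity) ?_
  have hl : 1 + P/b = (P + b)/b := by field_simp; ring
  have hr : 2 * (1 + (P - q)/(q + b)) = 2 * (P + b)/(q + b) := by field_simp; ring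
  rw [hl, hr, div_le_div_iff₀ hb (by positivity)]
  nlinarith

theorem stmt10 (b1 b2 b3 b4 P q1 q2 D1 D2 D3 D4 : ℝ)
    (hb2 : 0 < b2) (h21 : b2 ≤ b1) (h14 : b1 ≤ b4) (h43 : b4 ≤ b3) (hP : 0 < P)
    (hD1 : D1 = 1/2 * Real.logb 2 (1 + P/b1))
    (hD2 : D2 = 1/2 * Real.logb 2 (1 + P/b2))
    (hD3 : D3 = 1/2 * Real.logb 2 (1 + P/b3))
    (hD4 : D4 = 1/2 * Real.logb 2 (1 + P/b4))
    (hq2 : q2 = min P b4) (hq1 : q1 = P - q2) :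
    1/2 * Real.logb 2 (1 + q2/b2) + 1/2 ≥ D2 - D4 ∧
    1/2 * Real.logb 2 (1 + q2/b1) + 1/2 ≥ D1 - D4 ∧
    1/2 * Real.logb 2 (1 + q1/(q2 + b4)) + 1/2 ≥ D4 ∧
    1/2 * Real.logb 2 (1 + q1/(q2 + b3)) + 1/2 ≥ D3 := by
  subst hD1 hD2 hD3 hD4 hq1 hq2
  have hb1 : 0 < b1 := by linarith
  have hb4 : 0 < b4 := by linarith
  have hb3 : 0 < b3 := by linarith
  have hq : 0 < min P b4 := lt_min hP hb4
  have hqb4 : min P b4 ≤ b4 := min_le_right P b4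
  exact ⟨by linarith [half_logb_sub_le hb2 hb4 hP], by linarith [half_logb_sub_le hb1 hb4 hP],
    half_logb_le_residual_add_half hb4 hq hqb4 hP,
    half_logb_le_residual_add_half hb3 hq (hqb4.trans h43) hP⟩
end

section
/- Suppose b₃ ≥ b₁ ≥ b₄ ≥ b₂ > 0 and P ≥ b₁. Then (1/2)·log((b₁ + b₂)/b₂) + (1/2)·log((P + b₄)/(b₁ + b₄)) + 1/2 ≥ (1/2)·log((P + b₂)/b₂), and (1/2)·log((P + b₁)/(2b₁)) + 1/2 ≥ (1/2)·log((P + b₁)/b₁). -/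
theorem stmt12 (b1 b2 b3 b4 P : ℝ)
    (hb2 : 0 < b2) (h24 : b2 ≤ b4) (h41 : b4 ≤ b1) (h13 : b1 ≤ b3)
    (hP0 : 0 < P) (hP : b1 ≤ P) :
    1/2 * Real.logb 2 ((b1 + b2)/b2) + 1/2 * Real.logb 2 ((P + b4)/(b1 + b4)) + 1/2 ≥
      1/2 * Real.logb 2 ((P + b2)/b2) ∧
    1/2 * Real.logb 2 ((P + b1)/(2*b1)) + 1/2 ≥ 1/2 * Real.logb 2 ((P + b1)/b1) := by
  have hb4 : 0 < b4 := hb2.trans_le h24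
  have hb1 : 0 < b1 := hb4.trans_le h41
  have logb_two_two : Real.logb 2 (2 : ℝ) = 1 := Real.logb_self_eq_one one_lt_two
  constructor
  · have hle : (P + b2)/b2 ≤ (b1 + b2)/b2 * ((P + b4)/(b1 + b4)) * 2 := by
      rw [div_mul_div_comm, div_mul_eq_mul_div, div_le_div_iff₀ hb2 (by positivity)]
      have hprod : (P + b2) * (b1 + b4) ≤ (P + b4) * (2 * (b1 + b2)) :=
        mul_le_mul (by linarith) (by linarith) (by positivity) (by positivity)
      nlinarith [mul_le_mul_of_nonneg_right hprod hb2.le]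
    have hlog := Real.logb_le_logb_of_le one_lt_two (by positivity) hle
    rw [Real.logb_mul (by positivity) two_ne_zero,
      Real.logb_mul (by positivity) (by positivity), logb_two_two] at hlog
    linarith
  · have heq : (P + b1)/b1 = (P + b1)/(2*b1) * 2 := by field_simp
    rw [heq, Real.logb_mul (by positivity) two_ne_zero, logb_two_two]
    linarith
end

section
/- Suppose b₃ ≥ b₁ ≥ b₄ ≥ b₂ > 0. Set q₂ = min(P, b₄) and q₁ = P − q₂. Then (1/2)·log(1 + q₂/b₂) + 1/2 ≥ D₂ − D₄, (1/2)·log(1 + q₁/(q₂ + b₄)) + 1/2 ≥ D₄, and (1/2)·log(1 + q₁/(q₂ + b₃)) + 1/2 ≥ D₃. -/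
theorem half_logb_le_add_half {u v : ℝ} (hu : 0 < u) (hv : 0 < v) (h : v ≤ 2 * u) :
    1/2 * Real.logb 2 v ≤ 1/2 * Real.logb 2 u + 1/2 := by
  have h1 : Real.logb 2 v ≤ Real.logb 2 (2 * u) :=
    Real.logb_le_logb_of_le (by norm_num) hv h
  rw [Real.logb_mul (by norm_num) hu.ne', Real.logb_self_eq_one (by norm_num)] at h1
  linarith

/-- Treating a signal of power `q ≤ b` as extra noise costs at most half a bit. -/
theorem half_logb_le_of_interference_le {b P q : ℝ} (hb : 0 < b) (hq : 0 < q) (hqP : q ≤ P)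
    (hqb : q ≤ b) :
    1/2 * Real.logb 2 (1 + P/b) ≤ 1/2 * Real.logb 2 (1 + (P - q)/(q + b)) + 1/2 := by
  have hP : 0 < P := hq.trans_le hqP
  have e1 : 1 + (P - q)/(q + b) = (P + b)/(q + b) := by field_simp; ring
  have e2 : 1 + P/b = (P + b)/b := by field_simp; ring
  rw [e1, e2]
  refine half_logb_le_add_half (by positivity) (by positivity) ?_
  rw [← mul_div_assoc, div_le_div_iff₀ hb (by positivity)]
  nlinarith


theorem stmt13 (b1 b2 b3 b4 P q1 q2 D1 D2 D3 D4 : ℝ)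
    (hb2 : 0 < b2) (h24 : b2 ≤ b4) (h41 : b4 ≤ b1) (h13 : b1 ≤ b3) (hP : 0 < P)
    (hD1 : D1 = 1/2 * Real.logb 2 (1 + P/b1))
    (hD2 : D2 = 1/2 * Real.logb 2 (1 + P/b2))
    (hD3 : D3 = 1/2 * Real.logb 2 (1 + P/b3))
    (hD4 : D4 = 1/2 * Real.logb 2 (1 + P/b4))
    (hq2 : q2 = min P b4) (hq1 : q1 = P - q2) :
    1/2 * Real.logb 2 (1 + q2/b2) + 1/2 ≥ D2 - D4 ∧
    1/2 * Real.logb 2 (1 + q1/(q2 + b4)) + 1/2 ≥ D4 ∧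
    1/2 * Real.logb 2 (1 + q1/(q2 + b3)) + 1/2 ≥ D3 := by
  have hb4 : 0 < b4 := hb2.trans_le h24
  have hq : 0 < q2 := hq2 ▸ lt_min hP hb4
  have hqP : q2 ≤ P := hq2 ▸ min_le_left P b4
  have hqb : q2 ≤ b4 := hq2 ▸ min_le_right P b4
  subst hD2 hD3 hD4 hq1
  refine ⟨?_, half_logb_le_of_interference_le hb4 hq hqP hqb,
    half_logb_le_of_interference_le (by linarith) hq hqP (by linarith)⟩
  have key : 1 + P/b2 ≤ 2 * ((1 + q2/b2) * (1 + P/b4)) := by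
    have hprod : 1 + P/b2 ≤ (1 + q2/b2) * (1 + P/b4) := by
      rcases min_choice P b4 with h | h <;> rw [h] at hq2 <;> subst hq2
      · exact le_mul_of_one_le_right (by positivity) (le_add_of_nonneg_right (by positivity))
      · have e : (1 + q2/b2) * (1 + P/q2) = 1 + P/b2 + (q2/b2 + P/q2) := by
          field_simp
          ring
        rw [e]
        exact le_add_of_nonneg_right (by positivity)
    have : 0 < (1 + q2/b2) * (1 + P/b4) := by positivity
    linarith
  have h := half_logb_le_add_half (by positivity) (by positivity) key
  rw [Real.logb_mul (by positivity) (by positivity)] at h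
  linarith
end

section
/- Suppose b₃ ≥ b₁ ≥ b₄ ≥ b₂ > 0 and P ≥ b₁. Then there exists a real number p₄ with 0 ≤ p₄ ≤ b₁ such that 2·(p₄ + b₂)·(P + b₄)/(b₂·(b₁ + b₄)) ≥ (P + b₂)·b₄·(P + b₁)/(b₂·(P + b₄)·b₁) and 2·(b₁ + b₄)/(p₄ + b₄) ≥ (P + b₄)·b₁/(b₄·(P + b₁)). -/
theorem stmt14 (b1 b2 b3 b4 P : ℝ)
    (hb2 : 0 < b2) (h24 : b2 ≤ b4) (h41 : b4 ≤ b1) (h13 : b1 ≤ b3)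
    (hP0 : 0 < P) (hP : b1 ≤ P) :
    ∃ p4 : ℝ, 0 ≤ p4 ∧ p4 ≤ b1 ∧
      2*(p4 + b2)*(P + b4)/(b2*(b1 + b4)) ≥ (P + b2)*b4*(P + b1)/(b2*(P + b4)*b1) ∧
      2*(b1 + b4)/(p4 + b4) ≥ (P + b4)*b1/(b4*(P + b1)) := by
  have hb4 : 0 < b4 := hb2.trans_le h24
  have hb1 : 0 < b1 := hb4.trans_le h41
  refine ⟨b4, hb4.le, h41, ?_, ?_⟩
  · rw [ge_iff_le, div_le_div_iff₀ (by positivity) (by positivity)]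
    have key : (P + b1) * (b1 + b4) ≤ 2 * (P + b4) * b1 := by
      nlinarith [mul_nonneg (sub_nonneg.2 hP) (sub_nonneg.2 h41)]
    calc (P + b2) * b4 * (P + b1) * (b2 * (b1 + b4))
        = (P + b2) * b4 * b2 * ((P + b1) * (b1 + b4)) := by ring
      _ ≤ (P + b4) * (b4 + b2) * b2 * (2 * (P + b4) * b1) := by
          gcongr
          linarith
      _ = 2 * (b4 + b2) * (P + b4) * (b2 * (P + b4) * b1) := by ring
  · rw [ge_iff_le, div_le_div_iff₀ (by positivity) (by positivity)]
    calc (P + b4) * b1 * (b4 + b4)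
        ≤ (P + b1) * (b1 + b4) * (b4 + b4) := by
          gcongr
          linarith
      _ = 2 * (b1 + b4) * (b4 * (P + b1)) := by ring
end

section
/- Suppose b₃ ≥ b₁ ≥ b₄ ≥ b₂ > 0, P ≥ b₃, and b₃ ≥ 2b₁. Set s = (b₃ + 2b₁)·b₁/b₃ and p₄ = (b₃ + 2b₁ − b₄)·b₁/(b₃ + b₁). Then 0 ≤ p₄ ≤ s ≤ b₃, and the following four inequalities hold: (1/2)·log((p₄ + b₂)/b₂ · (b₃ + b₄)/(s + b₄)) + 1/2 ≥ D₂ − D₃; (1/2)·log((b₃ + b₁)/(s + b₁)) + 1/2 ≥ D₁ − D₃; (1/2)·log((P + b₁)/(b₃ + b₁) · (s + b₄)/(p₄ + b₄)) + 1/2 ≥ D₃; and (1/2)·log(1 + (P − b₃)/(2b₃)) + 1/2 ≥ D₃. -/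
theorem half_logb_le_add_half_s15 {x y : ℝ} (hy : 0 < y) (h : y ≤ 2 * x) :
    1/2 * Real.logb 2 y ≤ 1/2 * Real.logb 2 x + 1/2 := by
  have hx : 0 < x := by linarith
  have h1 : Real.logb 2 y ≤ Real.logb 2 (2 * x) :=
    Real.logb_le_logb_of_le (by norm_num) hy h
  rw [Real.logb_mul (by norm_num) hx.ne', Real.logb_self_eq_one (by norm_num)] at h1
  linarith

theorem half_logb_sub_half_logb_le {P a c x : ℝ} (ha : 0 < a) (hac : a ≤ c) (hP : 0 < P)
    (h : c ≤ 2 * x * a) :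
    1/2 * Real.logb 2 (1 + P/a) - 1/2 * Real.logb 2 (1 + P/c) ≤
      1/2 * Real.logb 2 x + 1/2 := by
  have hc : 0 < c := ha.trans_le hac
  have hPa : 0 < 1 + P/a := by positivity
  have hPc : 0 < 1 + P/c := by positivity
  rw [← mul_sub, ← Real.logb_div hPa.ne' hPc.ne']
  apply half_logb_le_add_half_s15 (div_pos hPa hPc)
  calc (1 + P/a) / (1 + P/c) = (a + P) / (c + P) * (c / a) := by field_simp
    _ ≤ 1 * (c / a) := by
      gcongr
      rw [div_le_one (by positivity)]
      linarith
    _ ≤ 2 * x := by rw [one_mul, div_le_iff₀ ha]; exact h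


theorem stmt15 (b1 b2 b3 b4 P s p4 D1 D2 D3 D4 : ℝ)
    (hb2 : 0 < b2) (h24 : b2 ≤ b4) (h41 : b4 ≤ b1) (h13 : b1 ≤ b3)
    (hP0 : 0 < P) (hP : b3 ≤ P) (h2b1 : 2*b1 ≤ b3)
    (hD1 : D1 = 1/2 * Real.logb 2 (1 + P/b1))
    (hD2 : D2 = 1/2 * Real.logb 2 (1 + P/b2))
    (hD3 : D3 = 1/2 * Real.logb 2 (1 + P/b3))
    (hD4 : D4 = 1/2 * Real.logb 2 (1 + P/b4))
    (hs : s = (b3 + 2*b1)*b1/b3)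
    (hp4 : p4 = (b3 + 2*b1 - b4)*b1/(b3 + b1)) :
    0 ≤ p4 ∧ p4 ≤ s ∧ s ≤ b3 ∧
    1/2 * Real.logb 2 ((p4 + b2)/b2 * ((b3 + b4)/(s + b4))) + 1/2 ≥ D2 - D3 ∧
    1/2 * Real.logb 2 ((b3 + b1)/(s + b1)) + 1/2 ≥ D1 - D3 ∧
    1/2 * Real.logb 2 ((P + b1)/(b3 + b1) * ((s + b4)/(p4 + b4))) + 1/2 ≥ D3 ∧
    1/2 * Real.logb 2 (1 + (P - b3)/(2*b3)) + 1/2 ≥ D3 := by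
  have hb4 : 0 < b4 := hb2.trans_le h24
  have hb1 : 0 < b1 := hb4.trans_le h41
  have hb3 : 0 < b3 := hb1.trans_le h13
  have hp4' : 0 ≤ p4 := by
    rw [hp4]
    exact div_nonneg (mul_nonneg (by linarith) hb1.le) (by positivity)
  have hps : p4 ≤ s := by
    rw [hp4, hs]
    gcongr <;> linarith
  have hs0 : 0 ≤ s := hp4'.trans hps
  have hsb3 : s ≤ b3 := by
    rw [hs, div_le_iff₀ hb3]
    nlinarith
  have hs_mul : b3 * s = (b3 + 2*b1)*b1 := by rw [hs]; field_simp
  have hp4_mul : (b3 + b1) * p4 = (b3 + 2*b1 - b4)*b1 := by rw [hp4]; field_simp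
  refine ⟨hp4', hps, hsb3, ?_, ?_, ?_, ?_⟩
  · rw [ge_iff_le, hD2, hD3]
    apply half_logb_sub_half_logb_le hb2 (by linarith) hP0
    have key : b3 * (s + b4) ≤ 2 * p4 * (b3 + b4) := by
      refine le_of_mul_le_mul_left ?_ (show 0 < b3 + b1 by positivity)
      have e1 : (b3 + b1) * (b3 * (s + b4)) = (b3 + b1) * ((b3 + 2*b1)*b1 + b3 * b4) := by
        rw [mul_add b3, hs_mul]
      have e2 : (b3 + b1) * (2 * p4 * (b3 + b4)) =
          2 * ((b3 + 2*b1 - b4)*b1) * (b3 + b4) := by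
        rw [← hp4_mul]; ring
      rw [e1, e2]
      have h1 : 0 ≤ (b1 - b4) * ((b3 - b1) * (b3 + 2*b1) + 2 * b1 * b4) :=
        mul_nonneg (by linarith)
          (add_nonneg (mul_nonneg (by linarith) (by positivity)) (by positivity))
      nlinarith
    have e : 2 * ((p4 + b2)/b2 * ((b3 + b4)/(s + b4))) * b2 =
        2 * (p4 + b2) * (b3 + b4) / (s + b4) := by field_simp
    rw [e, le_div_iff₀ (by positivity)]
    nlinarith [mul_pos hb2 (add_pos hb3 hb4)]
  · rw [ge_iff_le, hD1, hD3]
    apply half_logb_sub_half_logb_le hb1 h13 hP0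
    have e : 2 * ((b3 + b1)/(s + b1)) * b1 = 2 * (b3 + b1) * b1 / (s + b1) := by ring
    rw [e, le_div_iff₀ (by positivity)]
    linarith
  · rw [ge_iff_le, hD3]
    apply half_logb_le_add_half_s15 (by positivity)
    have h1 : 1 ≤ (s + b4)/(p4 + b4) := by
      rw [one_le_div (by positivity)]
      linarith
    have h2 : 1 + P/b3 ≤ 2 * ((P + b1)/(b3 + b1)) := by
      have e : 1 + P/b3 = (b3 + P)/b3 := by field_simp
      rw [e, ← mul_div_assoc, div_le_div_iff₀ hb3 (by positivity)]
      nlinarith [mul_nonneg (sub_nonneg.2 hP) (sub_nonneg.2 h13)]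
    have h3 : 0 ≤ (P + b1)/(b3 + b1) := by positivity
    nlinarith [mul_le_mul_of_nonneg_left h1 h3]
  · rw [ge_iff_le, hD3]
    apply half_logb_le_add_half_s15 (by positivity)
    apply le_of_eq
    field_simp
    ring
end

section
/- Suppose b₃ ≥ b₁ ≥ b₄ ≥ b₂ > 0, b₃ ≥ 3b₁, and P ≥ b₃. Set s = 2·b₁·(P + b₃)·(b₃ + b₁)/((P + b₁)·b₃) − b₁. Then 0 ≤ s ≤ b₃, and there exists a real number p₄ with 0 ≤ p₄ ≤ s such that 2·(p₄ + b₂)·(b₃ + b₄)/(b₂·(s + b₄)) ≥ (P + b₂)·b₄·(P + b₁)·b₃/(b₂·(P + b₄)·b₁·(P + b₃)) and 2·(P + b₁)·(s + b₄)/((b₃ + b₁)·(p₄ + b₄)) ≥ (P + b₄)·b₁·(P + b₃)/(b₄·(P + b₁)·b₃). -/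
theorem stmt16 (b1 b2 b3 b4 P s : ℝ)
    (hb2 : 0 < b2) (h24 : b2 ≤ b4) (h41 : b4 ≤ b1) (h13 : b1 ≤ b3)
    (h3b1 : 3*b1 ≤ b3) (hP0 : 0 < P) (hP : b3 ≤ P)
    (hs : s = 2*b1*(P + b3)*(b3 + b1)/((P + b1)*b3) - b1) :
    0 ≤ s ∧ s ≤ b3 ∧
    ∃ p4 : ℝ, 0 ≤ p4 ∧ p4 ≤ s ∧
      2*(p4 + b2)*(b3 + b4)/(b2*(s + b4)) ≥
        (P + b2)*b4*(P + b1)*b3/(b2*(P + b4)*b1*(P + b3)) ∧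
      2*(P + b1)*(s + b4)/((b3 + b1)*(p4 + b4)) ≥
        (P + b4)*b1*(P + b3)/(b4*(P + b1)*b3) := by
  have hb4 : 0 < b4 := hb2.trans_le h24
  have hb1 : 0 < b1 := hb4.trans_le h41
  have hb3 : 0 < b3 := hb1.trans_le h13
  have hs_lower : b1 ≤ s := by
    have : 2*b1 ≤ 2*b1*(P + b3)*(b3 + b1)/((P + b1)*b3) := by
      rw [le_div_iff₀ (by positivity), mul_assoc (2*b1)]
      have : (P + b1)*b3 ≤ (P + b3)*(b3 + b1) := by gcongr; linarith
      gcongr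
    linarith
  have hs_upper : s ≤ b3 := by
    have : 2*b1*(P + b3)*(b3 + b1)/((P + b1)*b3) ≤ b3 + b1 := by
      rw [div_le_iff₀ (by positivity), mul_comm (b3 + b1)]
      refine mul_le_mul_of_nonneg_right ?_ (by positivity)
      nlinarith [mul_le_mul_of_nonneg_left hP hb1.le, mul_le_mul_of_nonneg_left h3b1 hP0.le]
    linarith
  have hs0 : 0 < s := hb1.trans_le hs_lower
  refine ⟨hs0.le, hs_upper, ?_⟩
  obtain ⟨X, hX⟩ : ∃ X, X = (P + b1)*b3/(b1*(P + b3)) := ⟨_, rfl⟩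
  have hX0 : 0 < X := by rw [hX]; positivity
  have hXb : b1*X ≤ b3 := by
    have : b1*X = (P + b1)*b3/(P + b3) := by rw [hX]; field_simp
    rw [this, div_le_iff₀ (by positivity)]
    nlinarith
  have hsX : (s + b1)*X = 2*(b3 + b1) := by rw [hs, hX]; field_simp; ring
  obtain ⟨y, hy⟩ : ∃ y, y = (s + b4)*X/(b3 + b1) := ⟨_, rfl⟩
  have hy1 : 1 ≤ y := by
    rw [hy, le_div_iff₀ (by positivity)]
    nlinarith [mul_pos hb4 hX0]
  have hy2 : y ≤ 2 := by
    rw [hy, div_le_iff₀ (by positivity), ← hsX]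
    gcongr
  obtain ⟨u, hu⟩ : ∃ u, u = (P + b1)/(P + b4) := ⟨_, rfl⟩
  have hu1 : 1 ≤ u := by rw [hu, le_div_iff₀ (by positivity)]; linarith
  obtain ⟨v, hv⟩ : ∃ v, v = (P + b2)/(P + b4)*((b3 + b1)/(b3 + b4)) := ⟨_, rfl⟩
  have hv0 : (P + b2)/(P + b4) ≤ 1 := by rw [div_le_one (by positivity)]; linarith
  have hvw : v ≤ (b3 + b1)/(b3 + b4) := by
    rw [hv]; exact mul_le_of_le_one_left (by positivity) hv0
  have hv1 : v ≤ 4/3 := by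
    refine hvw.trans ?_
    rw [div_le_iff₀ (by positivity)]; linarith
  have hv2 : b4*v ≤ b1 := by
    refine (mul_le_mul_of_nonneg_left hvw hb4.le).trans ?_
    rw [← mul_div_assoc, div_le_iff₀ (by positivity)]
    nlinarith
  have hvp : 0 < v := by rw [hv]; positivity
  have hb4y : b4 ≤ b4*y := le_mul_of_one_le_right hb4.le hy1
  have hU : 2*(b4*y) ≤ 2*b4*u*y := by
    nlinarith [mul_le_mul_of_nonneg_left hu1 (hb4.trans_le hb4y).le]
  have hL : b4*v*y/2 ≤ 2/3*(b4*y) := by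
    nlinarith [mul_le_mul_of_nonneg_left hv1 (hb4.trans_le hb4y).le]
  have hLs : b4*v*y/2 ≤ s := by
    nlinarith [mul_le_mul_of_nonneg_left hy2 (mul_pos hb4 hvp).le]
  obtain ⟨p, hp⟩ : ∃ p, p = min s (2*b4*u*y - b4) := ⟨_, rfl⟩
  have hp0 : 0 ≤ p := by rw [hp]; exact le_min hs0.le (by linarith)
  have hpL : b4*v*y/2 ≤ p + b2 := by
    have : b4*v*y/2 - b2 ≤ p := by rw [hp]; exact le_min (by linarith) (by linarith)
    linarith
  have hpU : p + b4 ≤ 2*b4*u*y := by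
    have : p ≤ 2*b4*u*y - b4 := by rw [hp]; exact min_le_right _ _
    linarith
  refine ⟨p, hp0, hp ▸ min_le_left _ _, ?_, ?_⟩
  · calc (P + b2)*b4*(P + b1)*b3/(b2*(P + b4)*b1*(P + b3))
        = 2*(b4*v*y/2)*(b3 + b4)/(b2*(s + b4)) := by
          rw [hv, hy, hX]; field_simp
      _ ≤ 2*(p + b2)*(b3 + b4)/(b2*(s + b4)) := by gcongr
  · calc (P + b4)*b1*(P + b3)/(b4*(P + b1)*b3)
        = 2*(P + b1)*(s + b4)/((b3 + b1)*(2*b4*u*y)) := by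
          rw [hu, hy, hX]; field_simp
      _ ≤ 2*(P + b1)*(s + b4)/((b3 + b1)*(p + b4)) := by gcongr
end

section
/- Let b₁, b₂, b₃, b₄ be positive reals with b₁ ≥ b₄ ≥ b₂ and 2b₁ ≤ b₃ ≤ 3b₁. Define a = 2b₁ − b₄, β = 4b₁² − 2b₁b₃ + b₁b₄ − b₂b₄, and c = 4b₁²b₄ − 2b₁b₃b₄ − b₁b₂b₄. Then for every real x ≥ b₃, one has a·x² + β·x + c ≥ 0. -/
theorem stmt17 (b1 b2 b3 b4 : ℝ)
    (hb1 : 0 < b1) (hb2 : 0 < b2) (hb3 : 0 < b3) (hb4 : 0 < b4)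
    (h41 : b4 ≤ b1) (h24 : b2 ≤ b4) (hlo : 2*b1 ≤ b3) (hhi : b3 ≤ 3*b1) :
    ∀ x : ℝ, b3 ≤ x →
      (2*b1 - b4) * x^2 + (4*b1^2 - 2*b1*b3 + b1*b4 - b2*b4) * x +
        (4*b1^2*b4 - 2*b1*b3*b4 - b1*b2*b4) ≥ 0 := by
  intro x hx
  have hprod : b4 * (b1 + b3) ≤ b1 * (4 * b1) :=
    mul_le_mul h41 (by linarith) (by linarith) hb1.le
  -- The value at `b3`.
  have hval : 0 ≤ (b3 + b4) * (b1 * (4 * b1) - b4 * (b1 + b3)) +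
      b4 * (b1 + b3) * (b4 - b2) :=
    add_nonneg (mul_nonneg (by linarith) (by linarith))
      (mul_nonneg (by positivity) (by linarith))
  -- The derivative at `b3`.
  have hslope : 0 ≤ 2 * b3 * (b1 - b4) + 4 * b1 ^ 2 + b4 * (b1 - b2) := by
    have h1 : 0 ≤ b3 * (b1 - b4) := mul_nonneg hb3.le (by linarith)
    have h2 : 0 ≤ b4 * (b1 - b2) := mul_nonneg hb4.le (by linarith)
    nlinarith [sq_nonneg b1]
  have hlin := mul_nonneg hslope (sub_nonneg.2 hx)
  have hquad : 0 ≤ (2 * b1 - b4) * (x - b3) ^ 2 :=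
    mul_nonneg (by linarith) (sq_nonneg _)
  linarith
end
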